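/- Let C be a right triangulated category satisfying the condition: whenever B →g C →h TA →(-Tf) TB is a right triangle, then A →f B →g C →h TA is a right triangle. Then the shift functor T is faithful. -/

import Mathlib

open CategoryTheory Limits

attribute [local instance] CategoryTheory.Limits.hasBinaryBiproducts_of_finite_biproducts

universe v u

variable (C : Type u) [Category.{v} C]

/-- A sextuple `A ⟶ B ⟶ C ⟶ TA` in a category with an endofunctor `T`. -/
structure RightTriangle (T : C ⥤ C) where
  obj₁ : C
  obj₂ : C
  obj₃ : C
  mor₁ : obj₁ ⟶ obj₂
  mor₂ : obj₂ ⟶ obj₃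
  mor₃ : obj₃ ⟶ T.obj obj₁

variable {C}

/-- An isomorphism of sextuples. -/
def RightTriangle.Iso {T : C ⥤ C} (t t' : RightTriangle C T) : Prop :=
  ∃ (a : t.obj₁ ≅ t'.obj₁) (b : t.obj₂ ≅ t'.obj₂) (c : t.obj₃ ≅ t'.obj₃),
    t.mor₁ ≫ b.hom = a.hom ≫ t'.mor₁ ∧
    t.mor₂ ≫ c.hom = b.hom ≫ t'.mor₂ ∧
    t.mor₃ ≫ T.map a.hom = c.hom ≫ t'.mor₃

open ZeroObject in
/-- A right triangulated category structure on an additive category `C`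
with shift endofunctor `T`, following Assem–Beligiannis–Marmaridis:
axioms TR(0)-TR(5). -/
structure RightTriangulated [Preadditive C] [HasZeroObject C] [HasFiniteBiproducts C]
    (T : C ⥤ C) where
  shift_additive : T.Additive
  dist : Set (RightTriangle C T)
  /-- TR(0): closed under isomorphisms -/
  tr0 : ∀ t ∈ dist, ∀ t', RightTriangle.Iso t t' → t' ∈ dist
  /-- TR(1): `0 ⟶ A ⟶ A ⟶ 0` is a right triangle -/
  tr1 : ∀ A : C, (⟨0, A, A, 0, 𝟙 A, 0⟩ : RightTriangle C T) ∈ dist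
  /-- TR(2): every morphism extends to a right triangle -/
  tr2 : ∀ {A B : C} (f : A ⟶ B), ∃ (Z : C) (g : B ⟶ Z) (h : Z ⟶ T.obj A),
    (⟨A, B, Z, f, g, h⟩ : RightTriangle C T) ∈ dist
  /-- TR(3): rotation -/
  tr3 : ∀ t ∈ dist,
    (⟨t.obj₂, t.obj₃, T.obj t.obj₁, t.mor₂, t.mor₃, -T.map t.mor₁⟩ : RightTriangle C T) ∈ dist
  /-- TR(4): completion of commutative squares to morphisms of right triangles -/
  tr4 : ∀ t ∈ dist, ∀ t' ∈ dist, ∀ (a : t.obj₁ ⟶ t'.obj₁) (b : t.obj₂ ⟶ t'.obj₂),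
    t.mor₁ ≫ b = a ≫ t'.mor₁ →
    ∃ c : t.obj₃ ⟶ t'.obj₃,
      t.mor₂ ≫ c = b ≫ t'.mor₂ ∧ t.mor₃ ≫ T.map a = c ≫ t'.mor₃
  /-- TR(5): the octahedral axiom -/
  tr5 : ∀ {X Y Z U V W : C} (a : X ⟶ Y) (b : Y ⟶ Z) (c : Z ⟶ T.obj X)
    (d : Y ⟶ U) (e : U ⟶ V) (f : V ⟶ T.obj Y) (g : U ⟶ W) (h : W ⟶ T.obj X),
    (⟨X, Y, Z, a, b, c⟩ : RightTriangle C T) ∈ dist →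
    (⟨Y, U, V, d, e, f⟩ : RightTriangle C T) ∈ dist →
    (⟨X, U, W, a ≫ d, g, h⟩ : RightTriangle C T) ∈ dist →
    ∃ (l : Z ⟶ W) (i : W ⟶ V),
      b ≫ l = d ≫ g ∧ l ≫ h = c ∧ g ≫ i = e ∧ i ≫ f = h ≫ T.map a ∧
      (⟨Z, W, V, l, i, f ≫ T.map b⟩ : RightTriangle C T) ∈ dist

/-- Assumption 2.10: the rotation axiom can be reversed. -/
def Assumption210 [Preadditive C] [HasZeroObject C] [HasFiniteBiproducts C]
    {T : C ⥤ C} (rt : RightTriangulated T) : Prop :=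
  ∀ {A B Z : C} (f : A ⟶ B) (g : B ⟶ Z) (h : Z ⟶ T.obj A),
    (⟨B, Z, T.obj A, g, h, -T.map f⟩ : RightTriangle C T) ∈ rt.dist →
    (⟨A, B, Z, f, g, h⟩ : RightTriangle C T) ∈ rt.dist

/-- A morphism factors through an object of `S`. -/
def FactorsThru (S : Set C) {X Y : C} (f : X ⟶ Y) : Prop :=
  ∃ (D : C) (_ : D ∈ S) (u : X ⟶ D) (v : D ⟶ Y), u ≫ v = f

/-- `g : X ⟶ Y` is `S`-epic. -/
def SEpic (S : Set C) {X Y : C} (g : X ⟶ Y) : Prop :=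
  ∀ D ∈ S, ∀ u : D ⟶ Y, ∃ v : D ⟶ X, v ≫ g = u

/-- `f : X ⟶ Y` is `S`-monic. -/
def SMonic (S : Set C) {X Y : C} (f : X ⟶ Y) : Prop :=
  ∀ D ∈ S, ∀ u : X ⟶ D, ∃ v : Y ⟶ D, f ≫ v = u

/-- iterate of an endofunctor. -/
def iterFun (T : C ⥤ C) : ℕ → (C ⥤ C)
  | 0 => 𝟭 C
  | n + 1 => iterFun T n ⋙ T

/-- `S` is factor-through-epic: every `f ∈ [Tⁿ S](TX, TY)` with `n > 0` is of the
form `T f'` for some `f' ∈ [Tⁿ⁻¹ S](X, Y)`. -/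
def FactorThroughEpic (T : C ⥤ C) (S : Set C) : Prop :=
  ∀ (n : ℕ) (X Y : C) (f : T.obj X ⟶ T.obj Y),
    FactorsThru ((iterFun T (n + 1)).obj '' S) f →
    ∃ f' : X ⟶ Y, FactorsThru ((iterFun T n).obj '' S) f' ∧ T.map f' = f

/-- A subcategory (given by a set of objects) closed under isomorphisms,
finite direct sums and direct summands. -/
def IsSubcat [Preadditive C] [HasFiniteBiproducts C] (S : Set C) : Prop :=
  (∀ {X Y : C}, (X ≅ Y) → X ∈ S → Y ∈ S) ∧
  (∀ {X Y : C}, X ∈ S → Y ∈ S → (X ⊞ Y) ∈ S) ∧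
  (∀ {X Y : C} (s : Y ⟶ X) (r : X ⟶ Y), s ≫ r = 𝟙 Y → X ∈ S → Y ∈ S)

section Mutation

variable [Preadditive C] [HasZeroObject C] [HasFiniteBiproducts C]
  {T : C ⥤ C} (rt : RightTriangulated T)

/-- `μ(𝒵; 𝒟)`: objects `X` that lie in `𝒟` or are the left end of a right triangle
`X ⟶ D ⟶ Y ⟶ TX` with `Y ∈ 𝒵`, `D ∈ 𝒟`, the first map a left `𝒟`-approximation and
the second a right `𝒟`-approximation. -/
def muSet (𝒵 𝒟 : Set C) : Set C :=
  {X | X ∈ 𝒟 ∨ ∃ (D Y : C) (f : X ⟶ D) (g : D ⟶ Y) (h : Y ⟶ T.obj X),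
    (⟨X, D, Y, f, g, h⟩ : RightTriangle C T) ∈ rt.dist ∧
    D ∈ 𝒟 ∧ Y ∈ 𝒵 ∧ SMonic 𝒟 f ∧ SEpic 𝒟 g}

/-- `μ⁻¹(𝒳; 𝒟)`: objects `Y` that lie in `𝒟` or are the third term of a right triangle
`X ⟶ D ⟶ Y ⟶ TX` with `X ∈ 𝒳`, `D ∈ 𝒟`, the maps being left/right `𝒟`-approximations. -/
def muInvSet (𝒳 𝒟 : Set C) : Set C :=
  {Y | Y ∈ 𝒟 ∨ ∃ (X D : C) (f : X ⟶ D) (g : D ⟶ Y) (h : Y ⟶ T.obj X),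
    (⟨X, D, Y, f, g, h⟩ : RightTriangle C T) ∈ rt.dist ∧
    X ∈ 𝒳 ∧ D ∈ 𝒟 ∧ SMonic 𝒟 f ∧ SEpic 𝒟 g}

/-- `(𝒳, 𝒴)` is a `𝒟`-mutation pair. -/
def IsMutationPair (𝒳 𝒴 𝒟 : Set C) : Prop :=
  muInvSet rt 𝒳 𝒟 = 𝒴 ∧ muSet rt 𝒴 𝒟 = 𝒳

/-- `𝒵` is extension-closed. -/
def ExtClosed (𝒵 : Set C) : Prop :=
  ∀ t ∈ rt.dist, t.obj₁ ∈ 𝒵 → t.obj₃ ∈ 𝒵 → t.obj₂ ∈ 𝒵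

end Mutation

/-- Lemma 2.11: if the right triangulated category satisfies Assumption 2.10
(rotation can be reversed), then the shift functor `T` is faithful. -/
theorem shift_faithful_of_assumption210 {C : Type u} [Category.{v} C] [Preadditive C]
    [HasZeroObject C] [HasFiniteBiproducts C] {T : C ⥤ C} (rt : RightTriangulated T)
    (h210 : Assumption210 rt) :
    T.Faithful := by
  haveI := rt.shift_additive
  have key : ∀ {A B : C} (f : A ⟶ B), T.map f = 0 → f = 0 := by
    intro A B f hf
    obtain ⟨Z, g, h, ht⟩ := rt.tr2 f
    have hrot := rt.tr3 _ ht
    have h0 : (⟨A, B, Z, 0, g, h⟩ : RightTriangle C T) ∈ rt.dist := by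
      apply h210
      have e : -T.map (0 : A ⟶ B) = -T.map f := by rw [hf, T.map_zero]
      rw [e]
      exact hrot
    obtain ⟨c, hc, -⟩ := rt.tr4 _ h0 _ (rt.tr1 B) 0 (𝟙 B) (by simp)
    obtain ⟨d, hd, -⟩ := rt.tr4 _ (rt.tr3 _ (rt.tr1 A)) _ ht (𝟙 A) f rfl
    have hfg : f ≫ g = 0 := by
      refine hd.symm.trans ?_
      exact zero_comp
    have hgc : g ≫ c = 𝟙 B := by
      refine hc.trans ?_
      exact Category.comp_id _
    calc f = f ≫ (g ≫ c) := by rw [hgc, Category.comp_id]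
      _ = 0 := by rw [← Category.assoc, hfg, zero_comp]
  constructor
  intro X Y f g hfg
  have := key (f - g) (by rw [T.map_sub, hfg, sub_self])
  exact sub_eq_zero.mp this
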